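/- Let μ > 0 and let W_vol : (0,∞) → ℝ be a C² function with W_vol(t) = 0 if and only if t = 1, W_vol(t) → +∞ as t → 0⁺, W_vol(t) ≥ k t² for all t ≥ M for some constants M, k > 0, and W_vol''(1) > 0. For ε > 0 and F ∈ ℝ^{3×3} with det F > 0, define W_ε(F) := min_{n ∈ S²} (μ/2)(tr(Fᵀ L_{n,ε}^{−1} F)/(det F)^{2/3} − 3) + W_vol(det F), where L_{n,ε} := (1+ε)² n⊗n + (1+ε)^{−1}(I − n⊗n), and let 𝓤_ε := { R L_{n,ε}^{1/2} : n ∈ S², R ∈ SO(3) } with L_{n,ε}^{1/2} := (1+ε) n⊗n + (1+ε)^{−1/2}(I − n⊗n). Then there exist constants c > 0, δ > 0 and ε₀ > 0 such that for every ε ∈ (0, ε₀] and every F ∈ ℝ^{3×3} with det F > 0 and dist(F, 𝓤_ε) ≤ δ, one has W_ε(F) ≥ c·dist²(F, 𝓤_ε). -/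

import Mathlib

open Matrix Filter Topology

noncomputable section

/-- Frobenius norm of a real `3 × 3` matrix. -/
def frob (F : Matrix (Fin 3) (Fin 3) ℝ) : ℝ :=
  Real.sqrt (∑ i, ∑ j, (F i j) ^ 2)

/-- Distance (w.r.t. the Frobenius norm) from a matrix to a set of matrices. -/
def fdist (F : Matrix (Fin 3) (Fin 3) ℝ) (S : Set (Matrix (Fin 3) (Fin 3) ℝ)) : ℝ :=
  sInf ((fun G => frob (F - G)) '' S)

/-- The special orthogonal group `SO(3)` as a set of matrices. -/
def SO3 : Set (Matrix (Fin 3) (Fin 3) ℝ) :=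
  {R | R * Rᵀ = 1 ∧ R.det = 1}

/-- The unit sphere `S²` as a subtype of `ℝ³`. -/
def Sph : Type := {n : Fin 3 → ℝ // ∑ i, (n i) ^ 2 = 1}

/-- `L_{n,ε} = (1+ε)² n⊗n + (1+ε)⁻¹ (I - n⊗n)`. -/
def Lne (ε : ℝ) (n : Fin 3 → ℝ) : Matrix (Fin 3) (Fin 3) ℝ :=
  (1 + ε) ^ 2 • Matrix.vecMulVec n n + (1 + ε)⁻¹ • (1 - Matrix.vecMulVec n n)

/-- `L_{n,ε}^{1/2} = (1+ε) n⊗n + (1+ε)^{-1/2} (I - n⊗n)`. -/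
def LneHalf (ε : ℝ) (n : Fin 3 → ℝ) : Matrix (Fin 3) (Fin 3) ℝ :=
  (1 + ε) • Matrix.vecMulVec n n + ((1 + ε) ^ (-(1 : ℝ) / 2)) • (1 - Matrix.vecMulVec n n)

/-- The conditions on the volumetric energy `W_vol`. -/
structure WvolHyp (Wvol : ℝ → ℝ) : Prop where
  c2 : ContDiffOn ℝ 2 Wvol (Set.Ioi (0 : ℝ))
  zero_iff : ∀ t : ℝ, 0 < t → (Wvol t = 0 ↔ t = 1)
  tendsto_top : Tendsto Wvol (𝓝[>] (0 : ℝ)) atTop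
  quad_growth : ∃ M > (0 : ℝ), ∃ k > (0 : ℝ), ∀ t : ℝ, M ≤ t → k * t ^ 2 ≤ Wvol t
  second_deriv_pos : 0 < deriv (deriv Wvol) 1

/-- The small-strain nematic energy
`W_ε(F) = min_{n∈S²} (μ/2)(tr(Fᵀ L_{n,ε}⁻¹ F)/(det F)^{2/3} − 3) + W_vol(det F)`. -/
def Weps (μ : ℝ) (Wvol : ℝ → ℝ) (ε : ℝ) (F : Matrix (Fin 3) (Fin 3) ℝ) : ℝ :=
  ⨅ n : Sph, (μ / 2 * (Matrix.trace (Fᵀ * (Lne ε n.1)⁻¹ * F) / F.det ^ ((2 : ℝ) / 3) - 3)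
    + Wvol F.det)

/-- The wells `𝓤_ε = { R L_{n,ε}^{1/2} : n ∈ S², R ∈ SO(3) }`. -/
def Ueps (ε : ℝ) : Set (Matrix (Fin 3) (Fin 3) ℝ) :=
  {G | ∃ n : Fin 3 → ℝ, (∑ i, (n i) ^ 2 = 1) ∧ ∃ R ∈ SO3, G = R * LneHalf ε n}

/-- The axially symmetric matrix `x n⊗n + y (I - n⊗n)`. -/
def axial (n : Fin 3 → ℝ) (x y : ℝ) : Matrix (Fin 3) (Fin 3) ℝ :=
  x • vecMulVec n n + y • (1 - vecMulVec n n)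

lemma vecMulVec_self_mul_self {n : Fin 3 → ℝ} (hn : ∑ i, n i ^ 2 = 1) :
    vecMulVec n n * vecMulVec n n = vecMulVec n n := by
  rw [vecMulVec_mul_vecMulVec]
  have : n ⬝ᵥ n = 1 := by rw [← hn]; simp [dotProduct, sq]
  simp [this]

lemma axial_mul {n : Fin 3 → ℝ} (hn : ∑ i, n i ^ 2 = 1) (x y x' y' : ℝ) :
    axial n x y * axial n x' y' = axial n (x * x') (y * y') := by
  unfold axial
  simp only [add_mul, mul_add, mul_sub, sub_mul, smul_mul_assoc, mul_smul_comm,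
    vecMulVec_self_mul_self hn, mul_one, one_mul]
  module

lemma axial_one_one (n : Fin 3 → ℝ) : axial n 1 1 = 1 := by
  simp [axial]

lemma axial_transpose (n : Fin 3 → ℝ) (x y : ℝ) : (axial n x y)ᵀ = axial n x y := by
  simp [axial, transpose_vecMulVec]

lemma det_axial {n : Fin 3 → ℝ} (hn : ∑ i, n i ^ 2 = 1) (x y : ℝ) :
    (axial n x y).det = x * y ^ 2 := by
  have h : (axial n x y).det = y ^ 2 * (y + (x - y) * ∑ i, n i ^ 2) := by
    simp [axial, det_fin_three, vecMulVec_apply, Fin.sum_univ_three, one_apply]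
    ring
  rw [h, hn]; ring

lemma frob_sq (F : Matrix (Fin 3) (Fin 3) ℝ) : frob F ^ 2 = trace (Fᵀ * F) := by
  rw [frob, Real.sq_sqrt (by positivity), Finset.sum_comm]
  simp [trace, mul_apply, sq]

lemma frob_nonneg (F : Matrix (Fin 3) (Fin 3) ℝ) : 0 ≤ frob F := Real.sqrt_nonneg _

lemma abs_apply_le_frob (F : Matrix (Fin 3) (Fin 3) ℝ) (i j : Fin 3) : |F i j| ≤ frob F := by
  rw [← Real.sqrt_sq_eq_abs]
  apply Real.sqrt_le_sqrt
  calc F i j ^ 2 ≤ ∑ j, F i j ^ 2 :=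
        Finset.single_le_sum (f := fun j => F i j ^ 2) (fun _ _ => sq_nonneg _) (Finset.mem_univ j)
    _ ≤ _ := Finset.single_le_sum (f := fun i => ∑ j, F i j ^ 2) (fun _ _ => by positivity)
        (Finset.mem_univ i)

lemma frob_axial_mul_sq_le {n : Fin 3 → ℝ} (hn : ∑ i, n i ^ 2 = 1) {x y : ℝ} (hy : 0 ≤ y)
    (hxy : y ≤ x) (D : Matrix (Fin 3) (Fin 3) ℝ) :
    frob (axial n x y * D) ^ 2 ≤ x ^ 2 * frob D ^ 2 := by
  have key : x ^ 2 * frob D ^ 2 - frob (axial n x y * D) ^ 2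
      = (x ^ 2 - y ^ 2) * frob (axial n 0 1 * D) ^ 2 := by
    have h : ∀ p q : ℝ, trace ((axial n p q * D)ᵀ * (axial n p q * D))
        = trace (Dᵀ * axial n (p * p) (q * q) * D) := fun p q => by
      rw [transpose_mul, axial_transpose, ← axial_mul hn]
      simp only [mul_assoc]
    rw [frob_sq, frob_sq, frob_sq, h, h]
    simp only [axial, mul_add, add_mul, mul_sub, sub_mul, mul_smul_comm, smul_mul_assoc, trace_add,
      trace_sub, trace_smul, mul_one, smul_eq_mul]
    ring
  nlinarith [mul_nonneg (sub_nonneg.2 (pow_le_pow_left₀ hy hxy 2))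
    (sq_nonneg (frob (axial n 0 1 * D)))]

lemma mul_axial_transpose_mulVec {R : Matrix (Fin 3) (Fin 3) ℝ} (hR : R * Rᵀ = 1)
    (n : Fin 3 → ℝ) (x y : ℝ) : R * axial (Rᵀ *ᵥ n) x y = axial n x y * R := by
  have h : R * vecMulVec (Rᵀ *ᵥ n) (Rᵀ *ᵥ n) = vecMulVec n n * R := by
    rw [mul_vecMulVec, mulVec_mulVec, hR, one_mulVec, vecMulVec_mul, mulVec_transpose]
  simp only [axial, mul_add, add_mul, mul_sub, sub_mul, mul_smul_comm, smul_mul_assoc, h, mul_one,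
    one_mul]

lemma sum_sq_transpose_mulVec {R : Matrix (Fin 3) (Fin 3) ℝ} (hR : R * Rᵀ = 1)
    (n : Fin 3 → ℝ) : ∑ i, (Rᵀ *ᵥ n) i ^ 2 = ∑ i, n i ^ 2 := by
  have h : ∀ v : Fin 3 → ℝ, ∑ i, v i ^ 2 = v ⬝ᵥ v := fun v => by simp [dotProduct, sq]
  rw [h, h, dotProduct_mulVec, vecMul_transpose, mulVec_mulVec, hR, one_mulVec]

lemma cube_root_prod_bounds {σ : Fin 3 → ℝ} (hσ : ∀ i, 0 < σ i) {s : ℝ} (hs : 0 < s)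
    (h : ∏ i, σ i = s ^ 3) : 3 * s ≤ ∑ i, σ i ∧ 3 * s ^ 2 ≤ ∑ i, σ i ^ 2 := by
  have h0 := hσ 0
  have h1 := hσ 1
  have h2 := hσ 2
  simp only [Fin.prod_univ_three, Fin.sum_univ_three] at *
  have hle : 3 * s ≤ σ 0 + σ 1 + σ 2 := by
    refine le_of_pow_le_pow_left₀ three_ne_zero (by positivity) ?_
    nlinarith [mul_nonneg h0.le (sq_nonneg (σ 1 - σ 2)), mul_nonneg h1.le (sq_nonneg (σ 0 - σ 2)),
      mul_nonneg h2.le (sq_nonneg (σ 0 - σ 1)),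
      mul_nonneg (add_pos (add_pos h0 h1) h2).le (sq_nonneg (σ 1 - σ 2)),
      mul_nonneg (add_pos (add_pos h0 h1) h2).le (sq_nonneg (σ 0 - σ 2)),
      mul_nonneg (add_pos (add_pos h0 h1) h2).le (sq_nonneg (σ 0 - σ 1))]
  refine ⟨hle, ?_⟩
  nlinarith [sq_nonneg (σ 1 - σ 2), sq_nonneg (σ 0 - σ 2), sq_nonneg (σ 0 - σ 1)]

/-- Polar decomposition combined with the arithmetic-geometric mean inequality. -/
lemma exists_rotation_frob_sub_sq_le (G : Matrix (Fin 3) (Fin 3) ℝ) {s : ℝ} (hs : 0 < s)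
    (hdet : G.det = s ^ 3) :
    3 * s ^ 2 ≤ frob G ^ 2 ∧ ∃ R ∈ SO3, frob (G - R) ^ 2 ≤ frob G ^ 2 - 6 * s + 3 := by
  have hdet0 : 0 < G.det := by rw [hdet]; positivity
  have hpd : (Gᵀ * G).PosDef := by
    have := PosDef.conjTranspose_mul_self G (mulVec_injective_of_isUnit
      ((isUnit_iff_isUnit_det G).2 hdet0.ne'.isUnit))
    simpa using this
  set d := hpd.1.eigenvalues with hd
  have hdpos : ∀ i, 0 < d i := hpd.eigenvalues_pos
  obtain ⟨V, hV, hspec⟩ : ∃ V : Matrix (Fin 3) (Fin 3) ℝ, Vᵀ * V = 1 ∧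
      Gᵀ * G = V * diagonal d * Vᵀ := by
    refine ⟨hpd.1.eigenvectorUnitary, ?_, ?_⟩
    · simpa [star_eq_conjTranspose] using
        Unitary.coe_star_mul_self hpd.1.eigenvectorUnitary
    · have := hpd.1.spectral_theorem
      rw [Unitary.conjStarAlgAut_apply] at this
      simpa [star_eq_conjTranspose, Function.comp_def] using this
  have hV' : V * Vᵀ = 1 := mul_eq_one_comm.1 hV
  have hconj : ∀ p q : Fin 3 → ℝ, (V * diagonal p * Vᵀ) * (V * diagonal q * Vᵀ)
      = V * diagonal (fun i => p i * q i) * Vᵀ := fun p q => by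
    calc _ = V * diagonal p * (Vᵀ * V) * diagonal q * Vᵀ := by simp only [mul_assoc]
      _ = _ := by rw [hV, mul_one, mul_assoc V, diagonal_mul_diagonal]
  have htr : ∀ p : Fin 3 → ℝ, trace (V * diagonal p * Vᵀ) = ∑ i, p i := fun p => by
    rw [trace_mul_comm, ← mul_assoc, hV, one_mul, trace_diagonal]
  have hdetc : ∀ p : Fin 3 → ℝ, (V * diagonal p * Vᵀ).det = ∏ i, p i := fun p => by
    rw [det_mul_comm, ← mul_assoc, hV, one_mul, det_diagonal]
  set σ : Fin 3 → ℝ := fun i => √(d i) with hσ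
  have hσpos : ∀ i, 0 < σ i := fun i => Real.sqrt_pos.2 (hdpos i)
  have hσsq : ∀ i, σ i ^ 2 = d i := fun i => Real.sq_sqrt (hdpos i).le
  have hprod : ∏ i, σ i = s ^ 3 := by
    have h1 : (∏ i, σ i) ^ 2 = G.det ^ 2 := by
      rw [← Finset.prod_pow, Finset.prod_congr rfl fun i _ => hσsq i, ← hdetc, ← hspec, det_mul,
        det_transpose, sq]
    rw [← hdet]
    exact (pow_left_inj₀ (Finset.prod_nonneg fun i _ => (hσpos i).le) hdet0.le two_ne_zero).1 h1
  have hfrob : frob G ^ 2 = ∑ i, σ i ^ 2 := by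
    rw [frob_sq, hspec, htr]; simp only [hσsq]
  obtain ⟨hsum, hsumsq⟩ := cube_root_prod_bounds hσpos hs hprod
  refine ⟨hfrob ▸ hsumsq, ?_⟩
  set S := V * diagonal (fun i => (σ i)⁻¹) * Vᵀ with hS
  have hST : Sᵀ = S := by simp [hS, mul_assoc]
  have hRR : (G * S)ᵀ * (G * S) = 1 := by
    calc (G * S)ᵀ * (G * S) = S * (Gᵀ * G) * S := by rw [transpose_mul, hST]; simp only [mul_assoc]
      _ = V * diagonal (fun _ => 1) * Vᵀ := by
        rw [hspec, hconj, hconj]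
        congr 3; ext i
        have := (hσpos i).ne'
        rw [← hσsq]; field_simp
      _ = 1 := by simp [hV']
  refine ⟨G * S, ⟨mul_eq_one_comm.1 hRR, ?_⟩, ?_⟩
  · rw [det_mul, hdetc, Finset.prod_inv_distrib, hprod, hdet]
    field_simp
  · have hcross : trace (Gᵀ * (G * S)) = ∑ i, σ i := by
      rw [← mul_assoc, hspec, hconj, htr]
      refine Finset.sum_congr rfl fun i _ => ?_
      have := (hσpos i).ne'
      rw [← hσsq]; field_simp
    have hcross' : trace ((G * S)ᵀ * G) = ∑ i, σ i := by
      rw [← hcross, ← trace_transpose, transpose_mul, transpose_transpose]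
    have : frob (G - G * S) ^ 2 = frob G ^ 2 - 2 * ∑ i, σ i + 3 := by
      rw [frob_sq, frob_sq, transpose_sub, sub_mul, mul_sub, mul_sub, hRR, trace_sub, trace_sub,
        trace_sub, hcross, hcross']
      simp; ring
    linarith

lemma WvolHyp.apply_one {W : ℝ → ℝ} (hW : WvolHyp W) : W 1 = 0 := (hW.zero_iff 1 one_pos).2 rfl

lemma WvolHyp.nonneg {W : ℝ → ℝ} (hW : WvolHyp W) {t : ℝ} (ht : 0 < t) : 0 ≤ W t := by
  by_contra! hlt
  have hcont : ContinuousOn W (Set.Ioi 0) := hW.c2.continuousOn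
  rcases lt_trichotomy t 1 with h | rfl | h
  · obtain ⟨u, hu, hu0, hut⟩ := ((hW.tendsto_top.eventually_gt_atTop 0).and
      (Ioo_mem_nhdsGT ht)).exists
    obtain ⟨v, hv, hv0⟩ := intermediate_value_Icc' hut.le
      (hcont.mono fun x hx => hu0.trans_le hx.1) ⟨hlt.le, hu.le⟩
    have := (hW.zero_iff v (hu0.trans_le hv.1)).1 hv0
    linarith [hv.2]
  · exact hlt.ne hW.apply_one
  · obtain ⟨M, _, k, hk, hM⟩ := hW.quad_growth
    have hu : 0 ≤ W (max M t) := le_trans (by positivity) (hM _ (le_max_left _ _))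
    obtain ⟨v, hv, hv0⟩ := intermediate_value_Icc (le_max_right M t)
      (hcont.mono fun x hx => ht.trans_le hx.1) ⟨hlt.le, hu⟩
    have := (hW.zero_iff v (ht.trans_le hv.1)).1 hv0
    linarith [hv.1]

lemma WvolHyp.eventually_quadratic_le {W : ℝ → ℝ} (hW : WvolHyp W) :
    ∃ κ > 0, ∀ᶠ t in 𝓝 (1 : ℝ), κ * (t - 1) ^ 2 ≤ W t := by
  set a := deriv (deriv W) 1 with ha
  have ha0 : 0 < a := hW.second_deriv_pos
  have hdiff : ∀ᶠ t in 𝓝 (1 : ℝ), DifferentiableAt ℝ W t := by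
    filter_upwards [Ioi_mem_nhds one_pos] with t ht
    exact (hW.c2.contDiffAt (Ioi_mem_nhds ht)).differentiableAt (by norm_num)
  have hW1 : deriv W 1 = 0 := by
    refine IsLocalMin.deriv_eq_zero ?_
    filter_upwards [Ioi_mem_nhds one_pos] with t ht
    rw [hW.apply_one]
    exact hW.nonneg ht
  have hd2 : DifferentiableAt ℝ (deriv W) 1 := by
    by_contra h
    exact ha0.ne' (deriv_zero_of_not_differentiableAt h)
  have hq : ∀ t : ℝ, HasDerivAt (fun t : ℝ => a / 4 * (t - 1) ^ 2) (a / 2 * (t - 1)) t := fun t =>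
    ((((hasDerivAt_id t).sub_const 1).pow 2).const_mul (a / 4)).congr_deriv (by simp; ring)
  have hq' : HasDerivAt (fun t : ℝ => a / 2 * (t - 1)) (a / 2) 1 :=
    (((hasDerivAt_id (1 : ℝ)).sub_const 1).const_mul (a / 2)).congr_deriv (by simp)
  set g : ℝ → ℝ := fun t => W t - a / 4 * (t - 1) ^ 2 with hg
  have hg' : deriv g =ᶠ[𝓝 1] fun t => deriv W t - a / 2 * (t - 1) := by
    filter_upwards [hdiff] with t ht
    exact (ht.hasDerivAt.sub (hq t)).deriv
  have hmin : IsLocalMin g 1 := by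
    refine isLocalMin_of_deriv_deriv_pos ?_ ?_ ?_
    · have h : HasDerivAt (fun t => deriv W t - a / 2 * (t - 1)) (a - a / 2) 1 :=
        hd2.hasDerivAt.sub hq'
      rw [hg'.deriv_eq, h.deriv]
      linarith
    · rw [hg'.eq_of_nhds, hW1]; simp
    · exact (hdiff.self_of_nhds.hasDerivAt.sub (hq 1)).continuousAt
  refine ⟨a / 4, by positivity, ?_⟩
  filter_upwards [hmin] with t ht
  simp only [hg, hW.apply_one] at ht
  linarith

lemma exists_abs_det_sub_det_lt (B : ℝ) {η : ℝ} (hη : 0 < η) :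
    ∃ δ > 0, ∀ F G : Matrix (Fin 3) (Fin 3) ℝ, frob G ≤ B → frob (F - G) < δ →
      |F.det - G.det| < η := by
  set K : Set (Fin 3 → Fin 3 → ℝ) :=
    Set.univ.pi fun _ => Set.univ.pi fun _ => Set.Icc (-(B + 1)) (B + 1) with hKdef
  have hK : IsCompact K := isCompact_univ_pi fun _ => isCompact_univ_pi fun _ => isCompact_Icc
  have hc : Continuous fun f : Fin 3 → Fin 3 → ℝ => (of f).det := by
    have : Continuous fun A : Matrix (Fin 3) (Fin 3) ℝ => A.det := continuous_id.matrix_det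
    exact this
  obtain ⟨δ, hδ, h⟩ := Metric.uniformContinuousOn_iff.1
    (hK.uniformContinuousOn_of_continuous hc.continuousOn) η hη
  refine ⟨min δ 1, by positivity, fun F G hG hFG => ?_⟩
  have hentry : ∀ i j, |F i j - G i j| < min δ 1 := fun i j =>
    (abs_apply_le_frob (F - G) i j).trans_lt hFG
  have hGij : ∀ i j, |G i j| ≤ B := fun i j => (abs_apply_le_frob G i j).trans hG
  have hFK : (fun i j => F i j) ∈ K := fun i _ j _ => by
    refine abs_le.1 ?_
    have h1 := abs_sub_abs_le_abs_sub (F i j) (G i j)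
    have h2 := (hentry i j).le.trans (min_le_right _ _)
    linarith [hGij i j]
  have hGK : (fun i j => G i j) ∈ K := fun i _ j _ =>
    abs_le.1 ((hGij i j).trans (by linarith))
  refine h _ hFK _ hGK ?_
  exact (dist_pi_lt_iff hδ).2 fun i => (dist_pi_lt_iff hδ).2 fun j =>
    (hentry i j).trans_le (min_le_left _ _)

lemma fdist_le_frob_sub {F G : Matrix (Fin 3) (Fin 3) ℝ} {S : Set (Matrix (Fin 3) (Fin 3) ℝ)}
    (hG : G ∈ S) : fdist F S ≤ frob (F - G) :=
  csInf_le ⟨0, by rintro _ ⟨A, _, rfl⟩; exact frob_nonneg _⟩ ⟨G, hG, rfl⟩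

lemma fdist_nonneg (F : Matrix (Fin 3) (Fin 3) ℝ) (S : Set (Matrix (Fin 3) (Fin 3) ℝ)) :
    0 ≤ fdist F S :=
  Real.sInf_nonneg (by rintro _ ⟨A, _, rfl⟩; exact frob_nonneg _)

lemma exists_unit_vector : ∃ n : Fin 3 → ℝ, ∑ i, n i ^ 2 = 1 :=
  ⟨![1, 0, 0], by simp [Fin.sum_univ_three]⟩

lemma rpow_neg_half_bounds {a : ℝ} (ha : 1 ≤ a) :
    0 < a ^ (-(1 : ℝ) / 2) ∧ a ^ (-(1 : ℝ) / 2) ≤ 1 ∧ (a ^ (-(1 : ℝ) / 2)) ^ 2 = a⁻¹ := by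
  have ha0 : 0 < a := one_pos.trans_le ha
  refine ⟨Real.rpow_pos_of_pos ha0 _, Real.rpow_le_one_of_one_le_of_nonpos ha (by norm_num), ?_⟩
  rw [← Real.rpow_natCast, ← Real.rpow_mul ha0.le, ← Real.rpow_neg_one]
  norm_num

lemma LneHalf_eq_axial (ε : ℝ) (n : Fin 3 → ℝ) :
    LneHalf ε n = axial n (1 + ε) ((1 + ε) ^ (-(1 : ℝ) / 2)) := rfl

lemma LneHalf_mul_mem_Ueps {ε : ℝ} {n : Fin 3 → ℝ} (hn : ∑ i, n i ^ 2 = 1)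
    {R : Matrix (Fin 3) (Fin 3) ℝ} (hR : R ∈ SO3) : LneHalf ε n * R ∈ Ueps ε :=
  ⟨Rᵀ *ᵥ n, (sum_sq_transpose_mulVec hR.1 n).trans hn, R, hR,
    (mul_axial_transpose_mulVec hR.1 n _ _).symm⟩

lemma det_eq_one_of_mem_Ueps {ε : ℝ} (hε : 0 < ε) {G : Matrix (Fin 3) (Fin 3) ℝ}
    (hG : G ∈ Ueps ε) : G.det = 1 := by
  obtain ⟨n, hn, R, hR, rfl⟩ := hG
  have ha : 0 < 1 + ε := by linarith
  rw [det_mul, hR.2, LneHalf_eq_axial, det_axial hn, (rpow_neg_half_bounds (by linarith)).2.2,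
    mul_inv_cancel₀ ha.ne', one_mul]

lemma frob_le_of_mem_Ueps {ε : ℝ} (hε : 0 < ε) (hε1 : ε ≤ 1) {G : Matrix (Fin 3) (Fin 3) ℝ}
    (hG : G ∈ Ueps ε) : frob G ≤ 4 := by
  obtain ⟨n, hn, R, hR, rfl⟩ := hG
  obtain ⟨hb0, hb1, -⟩ := rpow_neg_half_bounds (a := 1 + ε) (by linarith)
  have h1 : frob (R * LneHalf ε n) ^ 2 = frob (LneHalf ε n * 1) ^ 2 := by
    rw [frob_sq, frob_sq, transpose_mul, mul_one, mul_assoc, ← mul_assoc Rᵀ,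
      mul_eq_one_comm.1 hR.1, one_mul]
  have h2 := frob_axial_mul_sq_le hn (x := 1 + ε) hb0.le (by linarith) 1
  rw [← LneHalf_eq_axial, ← h1] at h2
  have h3 : frob (1 : Matrix (Fin 3) (Fin 3) ℝ) ^ 2 = 3 := by simp [frob_sq]
  rw [h3] at h2
  refine abs_le_of_sq_le_sq' ?_ (by norm_num) |>.2
  nlinarith

lemma inv_Lne {ε : ℝ} (hε : 0 < ε) {n : Fin 3 → ℝ} (hn : ∑ i, n i ^ 2 = 1) :
    (Lne ε n)⁻¹ = axial n ((1 + ε) ^ 2)⁻¹ (1 + ε) := by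
  have ha : 1 + ε ≠ 0 := by positivity
  refine inv_eq_right_inv ?_
  change axial n ((1 + ε) ^ 2) (1 + ε)⁻¹ * _ = 1
  rw [axial_mul hn, mul_inv_cancel₀ (pow_ne_zero 2 ha), inv_mul_cancel₀ ha, axial_one_one]

/-- For every director `n`, the quantity `tr(Fᵀ L_{n,ε}⁻¹ F)` controls the distance to the wells. -/
lemma fdist_Ueps_sq_le {ε : ℝ} (hε : 0 < ε) (hε1 : ε ≤ 1) {n : Fin 3 → ℝ}
    (hn : ∑ i, n i ^ 2 = 1) {F : Matrix (Fin 3) (Fin 3) ℝ} {s : ℝ} (hs : 0 < s)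
    (hdet : F.det = s ^ 3) :
    3 * s ^ 2 ≤ trace (Fᵀ * (Lne ε n)⁻¹ * F) ∧
      fdist F (Ueps ε) ^ 2 ≤ 4 * (trace (Fᵀ * (Lne ε n)⁻¹ * F) - 6 * s + 3) := by
  obtain ⟨hb0, hb1, hb2⟩ := rpow_neg_half_bounds (a := 1 + ε) (by linarith)
  set a := 1 + ε with haε
  set b := a ^ (-(1 : ℝ) / 2) with hb
  have ha : 0 < a := by positivity
  set G := axial n a⁻¹ b⁻¹ * F with hG
  have hFG : F = axial n a b * G := by
    rw [hG, ← mul_assoc, axial_mul hn, mul_inv_cancel₀ ha.ne', mul_inv_cancel₀ hb0.ne',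
      axial_one_one, one_mul]
  have htrG : trace (Fᵀ * (Lne ε n)⁻¹ * F) = frob G ^ 2 := by
    have h : axial n (a ^ 2)⁻¹ a = axial n a⁻¹ b⁻¹ * axial n a⁻¹ b⁻¹ := by
      rw [axial_mul hn, ← sq, ← sq, inv_pow, inv_pow, hb2, inv_inv]
    rw [inv_Lne hε hn, h, frob_sq, hG, transpose_mul, axial_transpose]
    simp only [mul_assoc]
  have hdetG : G.det = s ^ 3 := by
    rw [hG, det_mul, det_axial hn, inv_pow, hb2, inv_inv, inv_mul_cancel₀ ha.ne', one_mul, hdet]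
  obtain ⟨hle, R, hR, hdist⟩ := exists_rotation_frob_sub_sq_le G hs hdetG
  rw [htrG]
  refine ⟨hle, ?_⟩
  have h1 : fdist F (Ueps ε) ≤ frob (F - LneHalf ε n * R) :=
    fdist_le_frob_sub (LneHalf_mul_mem_Ueps hn hR)
  have h2 : F - LneHalf ε n * R = axial n a b * (G - R) := by
    rw [mul_sub, ← hFG]; rfl
  have h3 := frob_axial_mul_sq_le hn hb0.le (show b ≤ a by linarith) (G - R)
  rw [← h2] at h3
  have h4 := pow_le_pow_left₀ (fdist_nonneg F (Ueps ε)) h1 2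
  have h5 : a ^ 2 ≤ 4 := by nlinarith
  have h6 := mul_le_mul h5 hdist (sq_nonneg _) (by norm_num)
  linarith

/-- there exist `c > 0`, `δ > 0`, `ε₀ > 0` such that for every `ε ∈ (0, ε₀]`
and every `F` with `det F > 0` and `dist(F, 𝓤_ε) ≤ δ`, one has
`W_ε(F) ≥ c dist²(F, 𝓤_ε)`. -/
theorem Weps_lower_bound_near (μ : ℝ) (hμ : 0 < μ) (Wvol : ℝ → ℝ) (hW : WvolHyp Wvol) :
    ∃ c > (0 : ℝ), ∃ δ > (0 : ℝ), ∃ ε₀ > (0 : ℝ), ∀ ε : ℝ, 0 < ε → ε ≤ ε₀ →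
      ∀ F : Matrix (Fin 3) (Fin 3) ℝ, 0 < F.det → fdist F (Ueps ε) ≤ δ →
        c * (fdist F (Ueps ε)) ^ 2 ≤ Weps μ Wvol ε F := by
  obtain ⟨κ, hκ, hev⟩ := hW.eventually_quadratic_le
  obtain ⟨η, hη, hball⟩ := Metric.eventually_nhds_iff.1 hev
  obtain ⟨δ, hδ, hδdet⟩ := exists_abs_det_sub_det_lt 4 (lt_min hη one_pos)
  refine ⟨min (μ / 32) (κ / 12), by positivity, δ / 2, by positivity, 1, one_pos, ?_⟩
  intro ε hε hε1 F hF hdist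
  have hJ : |F.det - 1| < min η 1 := by
    obtain ⟨n₀, hn₀⟩ := exists_unit_vector
    have hne : ((fun G => frob (F - G)) '' Ueps ε).Nonempty :=
      ⟨_, _, LneHalf_mul_mem_Ueps hn₀ (R := 1) ⟨by simp, by simp⟩, rfl⟩
    obtain ⟨_, ⟨G, hG, rfl⟩, hlt⟩ := exists_lt_of_csInf_lt hne
      (lt_of_le_of_lt hdist (half_lt_self hδ))
    simpa [det_eq_one_of_mem_Ueps hε hG] using
      hδdet F G (frob_le_of_mem_Ueps hε hε1 hG) hlt
  have hWJ : κ * (F.det - 1) ^ 2 ≤ Wvol F.det :=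
    hball (by rw [Real.dist_eq]; exact hJ.trans_le (min_le_left _ _))
  set s := F.det ^ ((1 : ℝ) / 3) with hs
  have hs0 : 0 < s := Real.rpow_pos_of_pos hF _
  have hs3 : F.det = s ^ 3 := by
    rw [hs, ← Real.rpow_natCast, ← Real.rpow_mul hF.le]; norm_num
  have hs2 : F.det ^ ((2 : ℝ) / 3) = s ^ 2 := by
    rw [hs, ← Real.rpow_natCast, ← Real.rpow_mul hF.le]; norm_num
  have hsle : s ≤ 2 := by
    have := (abs_lt.1 (hJ.trans_le (min_le_right _ _))).2
    refine le_of_pow_le_pow_left₀ three_ne_zero (by norm_num) ?_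
    rw [← hs3]; linarith
  have : Nonempty Sph := exists_unit_vector.elim fun n hn => ⟨⟨n, hn⟩⟩
  refine le_ciInf fun n => ?_
  obtain ⟨hx, hd⟩ := fdist_Ueps_sq_le hε hε1 n.2 hs0 hs3
  rw [hs2]
  set T := trace (Fᵀ * (Lne ε n.1)⁻¹ * F) with hT
  set x := T / s ^ 2 - 3 with hxdef
  have hx0 : 0 ≤ x := sub_nonneg.2 ((le_div_iff₀ (by positivity)).2 hx)
  have hTx : T = s ^ 2 * (x + 3) := by rw [hxdef]; field_simp; ring
  have hsJ : (s - 1) ^ 2 ≤ (F.det - 1) ^ 2 := by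
    have h : (F.det - 1) ^ 2 = (s - 1) ^ 2 * (s ^ 2 + s + 1) ^ 2 := by rw [hs3]; ring
    rw [h]
    exact le_mul_of_one_le_right (sq_nonneg _) (one_le_pow₀ (by nlinarith))
  have hs4 : s ^ 2 * x ≤ 4 * x := mul_le_mul_of_nonneg_right (by nlinarith) hx0
  have hbound : fdist F (Ueps ε) ^ 2 ≤ 16 * x + 12 * (F.det - 1) ^ 2 := by
    have h : T - 6 * s + 3 = s ^ 2 * x + 3 * (s - 1) ^ 2 := by rw [hTx]; ring
    linarith
  calc min (μ / 32) (κ / 12) * fdist F (Ueps ε) ^ 2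
      ≤ min (μ / 32) (κ / 12) * (16 * x) + min (μ / 32) (κ / 12) * (12 * (F.det - 1) ^ 2) := by
        rw [← mul_add]; exact mul_le_mul_of_nonneg_left hbound (by positivity)
    _ ≤ μ / 32 * (16 * x) + κ / 12 * (12 * (F.det - 1) ^ 2) := by
        gcongr
        · exact min_le_left _ _
        · exact min_le_right _ _
    _ ≤ μ / 2 * x + Wvol F.det := by linarith
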